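/- Let G be a finite connected simple graph with diameter d(G). Then for every finite simple graph H, γ(G □ H) ≥ (⌊d(G)/3⌋ + 1)·γ(H). -/

import Mathlib

open SimpleGraph Finset

/-- `S` is a dominating set of `G`: every vertex is in `S` or adjacent to a vertex of `S`. -/
def IsDomSet {V : Type*} (G : SimpleGraph V) (S : Finset V) : Prop :=
  ∀ v : V, v ∈ S ∨ ∃ u ∈ S, G.Adj u v

/-- The domination number of a finite graph. -/
noncomputable def domNum {V : Type*} [Fintype V] (G : SimpleGraph V) : ℕ :=
  sInf {n | ∃ S : Finset V, S.card = n ∧ IsDomSet G S}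

/-- `G` is `H`-free: `G` has no induced subgraph isomorphic to `H`,
equivalently there is no graph embedding of `H` into `G`. -/
def IsFree {V W : Type*} (G : SimpleGraph V) (H : SimpleGraph W) : Prop :=
  ¬ Nonempty (H ↪g G)

lemma IsDomSet.domNum_le_card {V : Type*} [Fintype V] {G : SimpleGraph V} {S : Finset V}
    (hS : IsDomSet G S) : domNum G ≤ S.card :=
  Nat.sInf_le ⟨S, rfl, hS⟩

lemma exists_isDomSet_card_eq_domNum {V : Type*} [Fintype V] (G : SimpleGraph V) :
    ∃ S : Finset V, S.card = domNum G ∧ IsDomSet G S :=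
  Nat.sInf_mem (s := {n | ∃ S : Finset V, S.card = n ∧ IsDomSet G S})
    ⟨_, univ, rfl, fun v => Or.inl (mem_univ v)⟩

/-- Distances from a fixed vertex take all intermediate values along a walk. -/
lemma SimpleGraph.Walk.exists_dist_eq {V : Type*} {G : SimpleGraph V} (x : V) {u v : V}
    (p : G.Walk u v) {n : ℕ} (hu : G.dist x u ≤ n) (hv : n ≤ G.dist x v) :
    ∃ y, G.dist x y = n := by
  induction p with
  | nil => exact ⟨_, le_antisymm hu hv⟩
  | cons h p ih =>
    rcases hu.eq_or_lt with hu | hu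
    · exact ⟨_, hu⟩
    · refine ih ?_ hv
      have := h.diff_dist_adj (u := x)
      omega

/-- If `D` dominates `G □ H` and `T` contains the closed neighbourhood of `y`, then the part of
`D` lying over `T` has at least `domNum H` elements, since its projection dominates `H`. -/
lemma IsDomSet.domNum_le_card_filter {V W : Type*} [Fintype W] {G : SimpleGraph V}
    {H : SimpleGraph W} {D : Finset (V × W)} (hD : IsDomSet (G □ H) D) (T : V → Prop)
    [DecidablePred T] {y : V} (hy : T y) (hadj : ∀ z, G.Adj z y → T z) :
    domNum H ≤ (D.filter fun q => T q.1).card := by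
  classical
  have hdom : IsDomSet H ((D.filter fun q => T q.1).image Prod.snd) := by
    intro w
    simp only [mem_image, mem_filter]
    rcases hD (y, w) with h | ⟨⟨z, w'⟩, hz, h⟩
    · exact Or.inl ⟨_, ⟨h, hy⟩, rfl⟩
    · rcases boxProd_adj.mp h with ⟨hzy, rfl⟩ | ⟨hw, rfl⟩
      · exact Or.inl ⟨_, ⟨hz, hadj z hzy⟩, rfl⟩
      · exact Or.inr ⟨w', ⟨_, ⟨hz, hy⟩, rfl⟩, hw⟩
  exact hdom.domNum_le_card.trans card_image_le

theorem stmt_9 {V W : Type*} [Fintype V] [Fintype W] (G : SimpleGraph V) (hconn : G.Connected)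
    (H : SimpleGraph W) :
    (G.diam / 3 + 1) * domNum H ≤ domNum (G □ H) := by
  have := hconn.nonempty
  obtain ⟨D, hcard, hD⟩ := exists_isDomSet_card_eq_domNum (G □ H)
  obtain ⟨x, x', hx⟩ := G.exists_dist_eq_diam
  obtain ⟨p⟩ := hconn x x'
  calc (G.diam / 3 + 1) * domNum H
      = ∑ _i ∈ range (G.diam / 3 + 1), domNum H := by simp
    _ ≤ ∑ i ∈ range (G.diam / 3 + 1), (D.filter fun q => (G.dist x q.1 + 1) / 3 = i).card := by
      refine sum_le_sum fun i hi => ?_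
      rw [mem_range] at hi
      obtain ⟨y, hy⟩ := p.exists_dist_eq x (n := 3 * i) (by simp) (by omega)
      refine hD.domNum_le_card_filter (fun v => (G.dist x v + 1) / 3 = i) (y := y) (by omega)
        fun z hz => ?_
      have := hz.symm.diff_dist_adj (u := x)
      omega
    _ = (D.filter fun q => (G.dist x q.1 + 1) / 3 ∈ range (G.diam / 3 + 1)).card :=
      sum_card_fiberwise_eq_card_filter _ _ _
    _ ≤ D.card := card_filter_le _ _
    _ = domNum (G □ H) := hcard
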